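/- Let k ≥ 2, let f : (k+1)^V → ℝ be a nonnegative k-submodular function (not necessarily monotone) with f(0) = 0, let c be a cost function on V, let B > 0 be a budget, and let o* ∈ (k+1)^V with c(o*) ≤ B and supp(o*) ≠ ∅. Let y ⪯ o* with |supp(y)| = 1 and f(y) ≥ f(y') for every y' ⪯ o* with |supp(y')| = 1, and let y = s^{(0)} ⪯ s^{(1)} ⪯ … ⪯ s^{(m)} = s be a greedy sequence relative to o*. If there exists e ∈ supp(o*)∖supp(s) with c(s) + c(e) > B, then 3·f(s) ≥ f(o*). -/

import Mathlib

open Finset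

section KSubmodularDefs

variable {V : Type*} [Fintype V] [DecidableEq V] {k : ℕ}

/-- The support of a `k`-tuple `x : V → Fin (k+1)` (value `0` means "not selected"). -/
def ksupp (x : V → Fin (k+1)) : Finset V := Finset.univ.filter fun e => x e ≠ 0

/-- The meet `x ⊓ y`. -/
def kinf (x y : V → Fin (k+1)) : V → Fin (k+1) :=
  fun e => if x e = y e then x e else 0

/-- The join `x ⊔ y`. -/
def ksup (x y : V → Fin (k+1)) : V → Fin (k+1) :=
  fun e => if y e = 0 ∨ y e = x e then x e else if x e = 0 then y e else 0

/-- `f` is `k`-submodular. -/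
def KSubmodular (f : (V → Fin (k+1)) → ℝ) : Prop :=
  ∀ x y : V → Fin (k+1), f (ksup x y) + f (kinf x y) ≤ f x + f y

/-- The partial order `x ⪯ y` on `(k+1)^V`. -/
def kle (x y : V → Fin (k+1)) : Prop := ∀ e : V, x e = 0 ∨ x e = y e

/-- `f` is monotone with respect to `⪯`. -/
def KMonotone (f : (V → Fin (k+1)) → ℝ) : Prop :=
  ∀ x y : V → Fin (k+1), kle x y → f x ≤ f y

/-- The marginal gain `Δ_{e,j}(x)` of assigning element `e` to component `j`. -/
def margin (f : (V → Fin (k+1)) → ℝ) (x : V → Fin (k+1)) (e : V) (j : Fin (k+1)) : ℝ :=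
  f (Function.update x e j) - f x

/-- The total cost `c(x)` of a tuple. -/
def kcost (c : V → ℝ) (x : V → Fin (k+1)) : ℝ := ∑ e ∈ ksupp x, c e

/-- One step of a greedy sequence relative to `o`: pick `e ∉ supp x` and `j ∈ {1,…,k}`
maximizing the marginal gain over components (a), and with marginal density at least that of
every pair `(e', j')` with `e' ∈ supp o \ supp x` (b). -/
def GreedyStep (f : (V → Fin (k+1)) → ℝ) (c : V → ℝ) (o : V → Fin (k+1))
    (x x' : V → Fin (k+1)) : Prop :=
  ∃ e : V, ∃ j : Fin (k+1), x e = 0 ∧ j ≠ 0 ∧ x' = Function.update x e j ∧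
    (∀ j' : Fin (k+1), j' ≠ 0 → margin f x e j' ≤ margin f x e j) ∧
    (∀ e' : V, o e' ≠ 0 → x e' = 0 → ∀ j' : Fin (k+1), j' ≠ 0 →
      margin f x e' j' * c e ≤ margin f x e j * c e')

/-- `GreedyRun f c B s V0 out`: starting from partial solution `s` with remaining elements `V0`,
the greedy procedure with budget `B` (under some tie-breaking) can terminate with output `out`.
At each step a pair `(e, j)` of maximum marginal density among remaining elements is chosen;
`e` is added (placed in component `j`) iff it fits in the remaining budget, and is removed
from the remaining pool in either case. -/
inductive GreedyRun (f : (V → Fin (k+1)) → ℝ) (c : V → ℝ) (B : ℝ) :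
    (V → Fin (k+1)) → Finset V → (V → Fin (k+1)) → Prop where
  | done (s : V → Fin (k+1)) : GreedyRun f c B s ∅ s
  | take (s : V → Fin (k+1)) (V0 : Finset V) (e : V) (j : Fin (k+1))
      (out : V → Fin (k+1)) (he : e ∈ V0) (hj : j ≠ 0)
      (hbest : ∀ e' ∈ V0, ∀ j' : Fin (k+1), j' ≠ 0 →
        margin f s e' j' / c e' ≤ margin f s e j / c e)
      (hfit : kcost c s + c e ≤ B)
      (hrest : GreedyRun f c B (Function.update s e j) (V0.erase e) out) :
      GreedyRun f c B s V0 out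
  | skip (s : V → Fin (k+1)) (V0 : Finset V) (e : V) (j : Fin (k+1))
      (out : V → Fin (k+1)) (he : e ∈ V0) (hj : j ≠ 0)
      (hbest : ∀ e' ∈ V0, ∀ j' : Fin (k+1), j' ≠ 0 →
        margin f s e' j' / c e' ≤ margin f s e j / c e)
      (hnofit : ¬ kcost c s + c e ≤ B)
      (hrest : GreedyRun f c B s (V0.erase e) out) :
      GreedyRun f c B s V0 out

/-- The `k`-multilinear extension of `f`, as a function of `x : V → Fin (k+1) → ℝ`
(only the coordinates `x e j` with `j ≠ 0` are relevant). -/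
noncomputable def kext (f : (V → Fin (k+1)) → ℝ) (x : V → Fin (k+1) → ℝ) : ℝ :=
  ∑ s : V → Fin (k+1), f s *
    ∏ e : V,
      (if s e = 0 then 1 - ∑ j ∈ Finset.univ.erase (0 : Fin (k+1)), x e j else x e (s e))

/-- The partial derivative of `F` with respect to the coordinate `(e, j)` at the point `x`. -/
noncomputable def pderiv (F : (V → Fin (k+1) → ℝ) → ℝ) (e : V) (j : Fin (k+1))
    (x : V → Fin (k+1) → ℝ) : ℝ :=
  deriv (fun t : ℝ => F (Function.update x e (Function.update (x e) j t))) (x e j)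

/-- Membership in the domain `Δ_k^V` of the multilinear extension. -/
def inSimplex (x : V → Fin (k+1) → ℝ) : Prop :=
  (∀ e : V, ∀ j : Fin (k+1), j ≠ 0 → 0 ≤ x e j ∧ x e j ≤ 1) ∧
  (∀ e : V, ∑ j ∈ Finset.univ.erase (0 : Fin (k+1)), x e j ≤ 1)

end KSubmodularDefs

section KSubmodularLemmas

variable {V : Type*} [Fintype V] [DecidableEq V] {k : ℕ}

omit [DecidableEq V] in
theorem mem_ksupp {x : V → Fin (k+1)} {e : V} : e ∈ ksupp x ↔ x e ≠ 0 := by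
  simp [ksupp]

omit [Fintype V] [DecidableEq V] in
theorem kle.trans {x y z : V → Fin (k+1)} (hxy : kle x y) (hyz : kle y z) : kle x z := by
  intro a
  rcases hxy a with h | h
  · exact Or.inl h
  · rw [h]; exact hyz a

omit [Fintype V] in
theorem kle_update {x : V → Fin (k+1)} {e : V} (he : x e = 0) (j : Fin (k+1)) :
    kle x (Function.update x e j) := by
  intro a
  by_cases ha : a = e
  · subst ha; exact Or.inl he
  · right; simp [ha]

omit [Fintype V] in
/-- Orthant submodularity: marginal gains decrease along `⪯`. -/
theorem KSubmodular.margin_anti {f : (V → Fin (k+1)) → ℝ} (hsub : KSubmodular f)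
    {x z : V → Fin (k+1)} (hxz : kle x z) {e : V} (he : z e = 0) {j : Fin (k+1)} (hj : j ≠ 0) :
    margin f z e j ≤ margin f x e j := by
  have hx : x e = 0 := by
    rcases hxz e with h | h
    · exact h
    · rw [h, he]
  have hsup : ksup (Function.update x e j) z = Function.update z e j := by
    funext a
    by_cases ha : a = e
    · subst ha; simp [ksup, he]
    · have := hxz a
      simp only [ksup, Function.update_of_ne ha]
      grind
  have hinf : kinf (Function.update x e j) z = x := by
    funext a
    by_cases ha : a = e
    · subst ha; simp [kinf, he, hx, hj]
    · have := hxz a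
      simp only [kinf, Function.update_of_ne ha]
      grind
  have h := hsub (Function.update x e j) z
  rw [hsup, hinf] at h
  unfold margin
  linarith

omit [Fintype V] in
/-- Pairwise monotonicity: two distinct marginal gains of the same element sum to at least `0`. -/
theorem KSubmodular.margin_add_margin_nonneg {f : (V → Fin (k+1)) → ℝ} (hsub : KSubmodular f)
    {x : V → Fin (k+1)} {e : V} (he : x e = 0) {i j : Fin (k+1)} (hi : i ≠ 0) (hj : j ≠ 0)
    (hij : i ≠ j) : 0 ≤ margin f x e i + margin f x e j := by
  have hsup : ksup (Function.update x e i) (Function.update x e j) = x := by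
    funext a
    by_cases ha : a = e
    · subst ha; simp [ksup, he, hi, hj, hij.symm]
    · simp [ksup, ha]
  have hinf : kinf (Function.update x e i) (Function.update x e j) = x := by
    funext a
    by_cases ha : a = e
    · subst ha; simp [kinf, he, hij]
    · simp [kinf, ha]
  have h := hsub (Function.update x e i) (Function.update x e j)
  rw [hsup, hinf] at h
  unfold margin
  linarith

theorem exists_ne_zero_ne (hk : 2 ≤ k) (j : Fin (k+1)) : ∃ i : Fin (k+1), i ≠ 0 ∧ i ≠ j := by
  by_cases h : j = ⟨1, by omega⟩
  · refine ⟨⟨2, by omega⟩, ?_, ?_⟩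
    · simp [Fin.ext_iff]
    · simp [h, Fin.ext_iff]
  · refine ⟨⟨1, by omega⟩, ?_, fun h' => h h'.symm⟩
    simp [Fin.ext_iff]

omit [Fintype V] in
theorem KSubmodular.margin_nonneg_of_max (hk : 2 ≤ k) {f : (V → Fin (k+1)) → ℝ}
    (hsub : KSubmodular f) {x : V → Fin (k+1)} {e : V} (he : x e = 0) {j : Fin (k+1)}
    (hj : j ≠ 0) (hmax : ∀ j' ≠ 0, margin f x e j' ≤ margin f x e j) : 0 ≤ margin f x e j := by
  obtain ⟨i, hi, hij⟩ := exists_ne_zero_ne hk j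
  have := hsub.margin_add_margin_nonneg he hi hj hij
  linarith [hmax i hi]

/-- The tuple `o` overwritten by `s` on the support of `s`. -/
def koverwrite (o s : V → Fin (k+1)) : V → Fin (k+1) :=
  fun e => if s e = 0 then o e else s e

omit [Fintype V] [DecidableEq V] in
theorem koverwrite_of_kle {o s : V → Fin (k+1)} (h : kle s o) : koverwrite o s = o := by
  funext a
  have := h a
  unfold koverwrite
  grind

omit [Fintype V] in
theorem koverwrite_update (o s : V → Fin (k+1)) (e : V) {j : Fin (k+1)} (hj : j ≠ 0) :
    koverwrite o (Function.update s e j) = Function.update (koverwrite o s) e j := by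
  funext a
  by_cases ha : a = e
  · subst ha; simp [koverwrite, hj]
  · simp [koverwrite, ha]

theorem KSubmodular.koverwrite_le {f : (V → Fin (k+1)) → ℝ} (hsub : KSubmodular f)
    (o s : V → Fin (k+1)) :
    f (koverwrite o s) ≤ f s + ∑ e ∈ ksupp o \ ksupp s, margin f s e (o e) := by
  have key : ∀ T : Finset V, T ⊆ ksupp o \ ksupp s →
      f (fun a => if a ∈ T then o a else s a) ≤ f s + ∑ e ∈ T, margin f s e (o e) := by
    intro T
    induction T using Finset.induction_on with
    | empty => intro _; simp
    | insert a T ha ih =>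
      intro hT
      have hle : kle s (fun b => if b ∈ T then o b else s b) := by
        intro b
        by_cases hb : b ∈ T
        · left
          have := hT (Finset.mem_insert_of_mem hb)
          simpa [mem_ksupp] using (Finset.mem_sdiff.1 this).2
        · right; simp [hb]
      have haT := Finset.mem_sdiff.1 (hT (Finset.mem_insert_self a T))
      have hsa : s a = 0 := by simpa [mem_ksupp] using haT.2
      have h := hsub.margin_anti (e := a) hle (by simp [ha, hsa]) (mem_ksupp.1 haT.1)
      have hupd : (fun b => if b ∈ insert a T then o b else s b) =
          Function.update (fun b => if b ∈ T then o b else s b) a (o a) := by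
        funext b
        by_cases hb : b = a
        · subst hb; simp
        · simp [hb]
      have := ih ((Finset.subset_insert a T).trans hT)
      rw [Finset.sum_insert ha, hupd]
      unfold margin at h ⊢
      unfold margin at this
      linarith
  have h := key _ subset_rfl
  convert h using 2
  funext a
  simp only [koverwrite, Finset.mem_sdiff, mem_ksupp]
  grind

omit [Fintype V] in
/-- The loss caused by a locally best assignment of `e` is at most twice its marginal gain, and at
most the marginal gain itself when `e ∉ supp o`. -/
theorem KSubmodular.koverwrite_loss (hk : 2 ≤ k) {f : (V → Fin (k+1)) → ℝ}
    (hsub : KSubmodular f) (o : V → Fin (k+1)) {s : V → Fin (k+1)} {e : V} {j : Fin (k+1)}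
    (he : s e = 0) (hj : j ≠ 0) (hmax : ∀ j' ≠ 0, margin f s e j' ≤ margin f s e j) :
    f (koverwrite o s) ≤ f (koverwrite o (Function.update s e j)) +
      (if o e = 0 then 1 else 2) * margin f s e j := by
  have hnonneg := hsub.margin_nonneg_of_max hk he hj hmax
  set t := Function.update (koverwrite o s) e 0 with ht
  have hte : t e = 0 := by simp [ht]
  have hst : kle s t := by
    intro a
    by_cases ha : a = e
    · subst ha; exact Or.inl he
    · by_cases hs : s a = 0
      · exact Or.inl hs
      · right; simp [ht, ha, koverwrite, hs]
  have hnew : koverwrite o (Function.update s e j) = Function.update t e j := by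
    rw [koverwrite_update o s e hj, ht, Function.update_idem]
  have hold : koverwrite o s = Function.update t e (o e) := by
    rw [ht, Function.update_idem, eq_comm, Function.update_eq_self_iff]
    simp [koverwrite, he]
  rw [hnew, hold]
  by_cases ho : o e = 0
  · obtain ⟨i, hi, hij⟩ := exists_ne_zero_ne hk j
    have h1 := hsub.margin_add_margin_nonneg hte hi hj hij
    have h2 := hsub.margin_anti hst hte hi
    have h3 := hmax i hi
    have h4 : Function.update t e (o e) = t := by simp [ho, ← hte]
    rw [h4, if_pos ho]
    unfold margin at *
    linarith
  · rw [if_neg ho]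
    by_cases hoj : o e = j
    · rw [hoj]; linarith
    · have h1 := hsub.margin_add_margin_nonneg hte ho hj hoj
      have h2 := hsub.margin_anti hst hte ho
      have h3 := hmax (o e) ho
      unfold margin at *
      linarith

omit [Fintype V] in
theorem GreedyStep.kle {f : (V → Fin (k+1)) → ℝ} {c : V → ℝ} {o x x' : V → Fin (k+1)}
    (h : GreedyStep f c o x x') : kle x x' := by
  obtain ⟨e, j, he, -, rfl, -⟩ := h
  exact kle_update he j

/-- If `ρ` is `0` or the density at `z` of an element of `supp o \ supp z`, a greedy step below `z`
does not decrease the potential `f (koverwrite o x) + 2 * f x - ρ * c(supp x \ supp o)`. -/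
theorem GreedyStep.potential_le (hk : 2 ≤ k) {f : (V → Fin (k+1)) → ℝ} (hsub : KSubmodular f)
    {c : V → ℝ} (hc : ∀ e, 0 < c e) {o x x' z : V → Fin (k+1)} (h : GreedyStep f c o x x')
    (hxz : _root_.kle x z) {ρ : ℝ}
    (hρ : ρ = 0 ∨ ∃ e ∈ ksupp o \ ksupp z, ρ * c e = margin f z e (o e)) :
    f (koverwrite o x) + 2 * f x - ρ * ∑ e ∈ ksupp x \ ksupp o, c e ≤
      f (koverwrite o x') + 2 * f x' - ρ * ∑ e ∈ ksupp x' \ ksupp o, c e := by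
  obtain ⟨e, j, he, hj, rfl, hmax, hdens⟩ := h
  have hloss := hsub.koverwrite_loss hk o he hj hmax
  have hnonneg := hsub.margin_nonneg_of_max hk he hj hmax
  have hgain : ρ * c e ≤ margin f x e j := by
    rcases hρ with rfl | ⟨a, ha, hρa⟩
    · simpa using hnonneg
    · obtain ⟨hao, haz⟩ := Finset.mem_sdiff.1 ha
      rw [mem_ksupp] at hao
      have hza : z a = 0 := by simpa [mem_ksupp] using haz
      have hxa : x a = 0 := by
        rcases hxz a with h | h
        · exact h
        · rw [h, hza]
      have h1 := hsub.margin_anti hxz hza hao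
      have h2 := hdens a hao hxa (o a) hao
      have h3 := mul_le_mul_of_nonneg_right h1 (hc e).le
      refine le_of_mul_le_mul_right ?_ (hc a)
      calc ρ * c e * c a = ρ * c a * c e := by ring
        _ = margin f z a (o a) * c e := by rw [hρa]
        _ ≤ _ := h3.trans h2
  have hsupp : ksupp (Function.update x e j) = insert e (ksupp x) := by
    ext a
    by_cases ha : a = e
    · subst ha; simp [mem_ksupp, hj]
    · simp [mem_ksupp, ha]
  have hmargin : margin f x e j = f (Function.update x e j) - f x := rfl
  by_cases ho : o e = 0
  · have hnot : e ∉ ksupp x \ ksupp o := by simp [mem_ksupp, he]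
    rw [hsupp, Finset.insert_sdiff_of_notMem _ (by simp [mem_ksupp, ho]),
      Finset.sum_insert hnot, mul_add]
    rw [if_pos ho] at hloss
    linarith
  · rw [hsupp, Finset.insert_sdiff_of_mem _ (mem_ksupp.2 ho)]
    rw [if_neg ho] at hloss
    linarith

omit [Fintype V] [DecidableEq V] in
theorem exists_density_bound (c g : V → ℝ) (hc : ∀ e, 0 < c e) (T : Finset V) :
    ∃ ρ : ℝ, 0 ≤ ρ ∧ (ρ = 0 ∨ ∃ e ∈ T, ρ * c e = g e) ∧ ∀ e ∈ T, g e ≤ ρ * c e := by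
  by_cases h : ∃ e ∈ T, 0 < g e
  · obtain ⟨e₀, he₀, hpos⟩ := h
    obtain ⟨e, he, hmax⟩ := T.exists_max_image (fun e => g e / c e) ⟨e₀, he₀⟩
    refine ⟨g e / c e, (div_pos hpos (hc e₀)).le.trans (hmax e₀ he₀), Or.inr ⟨e, he, ?_⟩, ?_⟩
    · exact div_mul_cancel₀ _ (hc e).ne'
    · intro a ha
      exact (div_le_iff₀ (hc a)).1 (hmax a ha)
  · push Not at h
    exact ⟨0, le_rfl, Or.inl rfl, fun e he => by simpa using h e he⟩

end KSubmodularLemmas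

/-- Non-monotone case (`k ≥ 2`): if the greedy sequence relative to `o*` starts
from the best singleton `y ⪯ o*`, and at its end some element of `supp(o*) \ supp(s)` no longer
fits in the budget, then `3·f(s) ≥ f(o*)`. -/
theorem one_guess_greedy_rejection_nonmonotone
    {V : Type*} [Fintype V] [DecidableEq V] {k : ℕ} (hk : 2 ≤ k)
    (f : (V → Fin (k+1)) → ℝ)
    (hsub : KSubmodular f)
    (hnonneg : ∀ x : V → Fin (k+1), 0 ≤ f x) (hzero : f (fun _ => 0) = 0)
    (c : V → ℝ) (hc : ∀ e : V, 0 < c e) (B : ℝ) (hB : 0 < B)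
    (ostar : V → Fin (k+1)) (hoB : kcost c ostar ≤ B) (hone : (ksupp ostar).Nonempty)
    (y : V → Fin (k+1)) (hyle : kle y ostar) (hycard : (ksupp y).card = 1)
    (hybest : ∀ y' : V → Fin (k+1), kle y' ostar → (ksupp y').card = 1 → f y' ≤ f y)
    (m : ℕ) (s : ℕ → V → Fin (k+1))
    (h0 : s 0 = y)
    (hstep : ∀ i < m, GreedyStep f c ostar (s i) (s (i+1)))
    (hrej : ∃ e ∈ ksupp ostar \ ksupp (s m), B < kcost c (s m) + c e) :
    f ostar ≤ 3 * f (s m) := by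
  obtain ⟨r, hr, hrB⟩ := hrej
  have hchain : ∀ i ≤ m, kle (s i) (s m) := by
    intro i hi
    induction hi using Nat.decreasingInduction with
    | self => exact fun a => Or.inr rfl
    | of_succ i hi ih => exact (hstep i hi).kle.trans ih
  set z := s m with hz
  obtain ⟨ρ, hρ0, hρ, hdens⟩ :=
    exists_density_bound c (fun e => margin f z e (ostar e)) hc (ksupp ostar \ ksupp z)
  have hpot : ∀ i ≤ m, f ostar + 2 * f y ≤ f (koverwrite ostar (s i)) + 2 * f (s i) -
      ρ * ∑ e ∈ ksupp (s i) \ ksupp ostar, c e := by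
    intro i
    induction i with
    | zero =>
      intro _
      have hemp : ksupp y \ ksupp ostar = ∅ := by
        rw [Finset.sdiff_eq_empty_iff_subset]
        intro a ha
        rw [mem_ksupp] at ha ⊢
        rwa [← (hyle a).resolve_left ha]
      rw [h0, koverwrite_of_kle hyle, hemp]
      simp
    | succ i ih =>
      intro hi
      exact (ih (by omega)).trans
        ((hstep i (by omega)).potential_le hk hsub hc (hchain i (by omega)) hρ)
  have hfinal := hpot m le_rfl
  rw [← hz] at hfinal
  have hover := hsub.koverwrite_le ostar z
  obtain ⟨hro, hrz⟩ := Finset.mem_sdiff.1 hr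
  rw [mem_ksupp] at hro
  have hrejected : margin f z r (ostar r) ≤ f y := by
    have h1 := hsub.margin_anti (x := fun _ => 0) (z := z) (fun _ => Or.inl rfl)
      (by simpa [mem_ksupp] using hrz) hro
    have h2 : f (Function.update (fun _ => 0) r (ostar r)) ≤ f y := by
      apply hybest
      · intro a
        by_cases ha : a = r
        · subst ha; right; simp
        · left; simp [ha]
      · rw [Finset.card_eq_one]
        refine ⟨r, ?_⟩
        ext a
        by_cases ha : a = r
        · subst ha; simp [mem_ksupp, hro]
        · simp [mem_ksupp, ha]
    refine h1.trans ?_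
    unfold margin
    linarith
  have hrest : ∑ e ∈ (ksupp ostar \ ksupp z).erase r, margin f z e (ostar e) ≤
      ρ * ∑ e ∈ (ksupp ostar \ ksupp z).erase r, c e := by
    rw [Finset.mul_sum]
    exact Finset.sum_le_sum fun e he => hdens e (Finset.mem_of_mem_erase he)
  have hcost : ∑ e ∈ (ksupp ostar \ ksupp z).erase r, c e ≤ ∑ e ∈ ksupp z \ ksupp ostar, c e := by
    have h1 := Finset.add_sum_erase _ c hr
    have h2 := Finset.sum_inter_add_sum_sdiff (ksupp ostar) (ksupp z) c
    have h3 := Finset.sum_inter_add_sum_sdiff (ksupp z) (ksupp ostar) c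
    rw [Finset.inter_comm] at h3
    unfold kcost at hoB hrB
    linarith
  have hsplit := Finset.add_sum_erase _ (fun e => margin f z e (ostar e)) hr
  have hmul := mul_le_mul_of_nonneg_left hcost hρ0
  have hy := hnonneg y
  linarith
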